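/- Let Δ be a simplicial complex on X = {x_1,…,x_n}, K a field, and α = (k_1,…,k_n) ∈ ℕ^n with all k_i ≥ 1. Then the projective dimensions agree: pd_S(S/J_Δ) = pd_{S^α}(S^α/J_{Δ^α}). -/

import Mathlib

/-- An (abstract) simplicial complex: a collection of finite subsets of the vertex set
closed under taking subsets. -/
def IsComplex {V : Type*} (Δ : Set (Finset V)) : Prop :=
  ∀ ⦃F G : Finset V⦄, F ∈ Δ → G ⊆ F → G ∈ Δ

/-- `F` is a facet (maximal face) of `Δ`. -/
def IsFacet {V : Type*} (Δ : Set (Finset V)) (F : Finset V) : Prop :=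
  F ∈ Δ ∧ ∀ G ∈ Δ, F ⊆ G → F = G

/-- The faces of the expansion `⟨F⟩^α` of the simplex with facet `F`. -/
def simplexExpansion {V : Type*} [DecidableEq V] (F : Finset V) (α : V → ℕ) :
    Set (Finset ((v : V) × Fin (α v))) :=
  {G | G.image Sigma.fst ⊆ F ∧ Set.InjOn Sigma.fst (G : Set ((v : V) × Fin (α v)))}

/-- The expansion `Δ^α` of a simplicial complex `Δ` with respect to `α`. -/
def expansion {V : Type*} [DecidableEq V] (Δ : Set (Finset V)) (α : V → ℕ) :
    Set (Finset ((v : V) × Fin (α v))) :=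
  ⋃ F ∈ Δ, simplexExpansion F α

/-- `P_F`, the ideal generated by the variables belonging to `F`. -/
noncomputable def varIdeal (K : Type*) [Field K] {V : Type*} (F : Finset V) :
    Ideal (MvPolynomial V K) :=
  Ideal.span (MvPolynomial.X '' (F : Set V))

/-- `J_Δ = ⋂_{F ∈ 𝔉(Δ)} P_F`, the Alexander dual of the facet ideal of `Δ`. -/
noncomputable def dualFacetIdeal (K : Type*) [Field K] {V : Type*} (Δ : Set (Finset V)) :
    Ideal (MvPolynomial V K) :=
  ⨅ F ∈ {F | IsFacet Δ F}, varIdeal K F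

/-- `HasProjDimLE R n M` says that `M` admits a projective resolution of length at most `n`. -/
def HasProjDimLE (R : Type) [CommRing R] : ℕ → ∀ (M : Type) [AddCommGroup M] [Module R M], Prop
  | 0, M, _, _ => Module.Projective R M
  | n + 1, M, _, _ => ∃ (P : Type) (_ : AddCommGroup P) (_ : Module R P) (f : P →ₗ[R] M),
      Module.Projective R P ∧ Function.Surjective f ∧ HasProjDimLE R n (LinearMap.ker f)

/-- The projective dimension of a module: the length of a shortest projective resolution
(`⊤` if there is no finite projective resolution). -/
noncomputable def projDim (R : Type) [CommRing R] (M : Type) [AddCommGroup M] [Module R M] :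
    ℕ∞ :=
  sInf {n : ℕ∞ | ∃ k : ℕ, (k : ℕ∞) = n ∧ HasProjDimLE R k M}

open CategoryTheory TensorProduct

section ProjectiveDimension

variable {R : Type} [CommRing R]

lemma hasProjDimLE_iff_hasProjectiveDimensionLE (k : ℕ) (M : Type) [AddCommGroup M] [Module R M] :
    HasProjDimLE R k M ↔ HasProjectiveDimensionLE (ModuleCat.of R M) k := by
  induction k generalizing M with
  | zero =>
    rw [← projective_iff_hasProjectiveDimensionLE_zero, ← IsProjective.iff_projective]
    rfl
  | succ k ih =>
    have step (P : Type) [AddCommGroup P] [Module R P] (f : P →ₗ[R] M)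
        (hP : Module.Projective R P) (hf : Function.Surjective f) :
        HasProjectiveDimensionLE (ModuleCat.of R M) (k + 1) ↔
          HasProjDimLE R k (LinearMap.ker f) := by
      rw [ih]
      exact (LinearMap.shortExact_shortComplexKer hf).hasProjectiveDimensionLT_X₃_iff k
        ((IsProjective.iff_projective P).mp hP)
    refine Iff.intro (fun ⟨P, _, _, f, hP, hf, hk⟩ ↦ (step P f hP hf).mpr hk) fun h ↦ ?_
    have hf := Finsupp.linearCombination_id_surjective R M
    exact ⟨M →₀ R, inferInstance, inferInstance, _, inferInstance, hf,
      (step _ _ inferInstance hf).mp h⟩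

lemma HasProjDimLE.of_retract {k : ℕ} {M N : Type} [AddCommGroup M] [Module R M]
    [AddCommGroup N] [Module R N] (i : M →ₗ[R] N) (r : N →ₗ[R] M)
    (hri : r ∘ₗ i = LinearMap.id) (h : HasProjDimLE R k N) : HasProjDimLE R k M := by
  rw [hasProjDimLE_iff_hasProjectiveDimensionLE] at h ⊢
  let ret : Retract (ModuleCat.of R M) (ModuleCat.of R N) :=
    { i := ModuleCat.ofHom i
      r := ModuleCat.ofHom r
      retract := by rw [← ModuleCat.ofHom_comp, hri]; rfl }
  exact ret.hasProjectiveDimensionLT (k + 1)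

lemma HasProjDimLE.of_linearEquiv {k : ℕ} {M N : Type} [AddCommGroup M] [Module R M]
    [AddCommGroup N] [Module R N] (e : M ≃ₗ[R] N) (h : HasProjDimLE R k N) :
    HasProjDimLE R k M :=
  h.of_retract e.toLinearMap e.symm.toLinearMap (by ext; simp)

lemma projDim_congr {M N : Type} [AddCommGroup M] [Module R M]
    [AddCommGroup N] [Module R N] (e : M ≃ₗ[R] N) : projDim R M = projDim R N := by
  have h (k : ℕ) : HasProjDimLE R k M ↔ HasProjDimLE R k N :=
    ⟨.of_linearEquiv e.symm, .of_linearEquiv e⟩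
  simp only [projDim, h]

variable {T : Type} [CommRing T] [Algebra R T]

lemma HasProjDimLE.baseChange [Module.Flat R T] {k : ℕ} {M : Type} [AddCommGroup M] [Module R M]
    (h : HasProjDimLE R k M) : HasProjDimLE T k (T ⊗[R] M) := by
  induction k generalizing M with
  | zero =>
    have : Module.Projective R M := h
    exact inferInstanceAs (Module.Projective T (T ⊗[R] M))
  | succ k ih =>
    obtain ⟨P, _, _, f, hP, hf, hk⟩ := h
    exact ⟨T ⊗[R] P, inferInstance, inferInstance, f.baseChange T, inferInstance,
      LinearMap.lTensor_surjective T hf,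
      (ih hk).of_linearEquiv (LinearMap.tensorKerEquiv T T f).symm⟩

lemma projective_trans (R T N : Type*) [CommRing R] [CommRing T] [Algebra R T]
    [AddCommGroup N] [Module R N] [Module T N] [IsScalarTower R T N]
    [Module.Projective R T] [Module.Projective T N] : Module.Projective R N := by
  classical
  obtain ⟨s, hs⟩ := Module.projective_def'.mp ‹Module.Projective T N›
  have : Module.Projective R (N →₀ T) := .of_equiv (finsuppLequivDFinsupp R).symm
  exact .of_split (s.restrictScalars R) ((Finsupp.linearCombination T id).restrictScalars R)
    (LinearMap.ext fun x ↦ LinearMap.congr_fun hs x)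

lemma HasProjDimLE.restrictScalars [Module.Projective R T] {k : ℕ} {N : Type} [AddCommGroup N]
    [Module R N] [Module T N] [IsScalarTower R T N]
    (h : HasProjDimLE T k N) : HasProjDimLE R k N := by
  induction k generalizing N with
  | zero =>
    have : Module.Projective T N := h
    exact projective_trans R T N
  | succ k ih =>
    obtain ⟨P, _, _, f, hP, hf, hk⟩ := h
    let : Module R P := Module.compHom P (algebraMap R T)
    have : IsScalarTower R T P := IsScalarTower.of_compHom R T P
    exact ⟨P, inferInstance, inferInstance, f.restrictScalars R,
      projective_trans R T P, hf, ih (N := LinearMap.ker f) hk⟩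

lemma projDim_baseChange [Module.Projective R T] (ρ : T →ₗ[R] R) (hρ : ρ 1 = 1)
    (M : Type) [AddCommGroup M] [Module R M] :
    projDim T (T ⊗[R] M) = projDim R M := by
  have h (k : ℕ) : HasProjDimLE T k (T ⊗[R] M) ↔ HasProjDimLE R k M := by
    refine ⟨fun h ↦ ?_, .baseChange⟩
    refine h.restrictScalars.of_retract (TensorProduct.mk R T M 1)
      ((TensorProduct.lid R M).toLinearMap ∘ₗ ρ.rTensor M) ?_
    ext m
    simp [hρ]
  simp only [projDim, h]

lemma projDim_quotient_map [Module.Projective R T] (ρ : T →ₗ[R] R) (hρ : ρ 1 = 1) (I : Ideal R) :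
    projDim T (T ⧸ I.map (algebraMap R T)) = projDim R (R ⧸ I) := by
  rw [← projDim_baseChange ρ hρ]
  exact projDim_congr (Algebra.TensorProduct.quotIdealMapEquivTensorQuot T I).toLinearEquiv

end ProjectiveDimension

section Facets

variable {V : Type*} [DecidableEq V] {Δ : Set (Finset V)} {α : V → ℕ}

lemma mem_expansion {G : Finset ((v : V) × Fin (α v))} :
    G ∈ expansion Δ α ↔ ∃ F ∈ Δ, G.image Sigma.fst ⊆ F ∧
      Set.InjOn Sigma.fst (G : Set ((v : V) × Fin (α v))) := by
  simp only [expansion, simplexExpansion, Set.mem_iUnion, Set.mem_ofPred_eq, exists_prop]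

lemma IsFacet.image_fst (hα : ∀ v, 1 ≤ α v) {G : Finset ((v : V) × Fin (α v))}
    (hG : IsFacet (expansion Δ α) G) : IsFacet Δ (G.image Sigma.fst) := by
  obtain ⟨hG, hmax⟩ := hG
  obtain ⟨F, hF, hGF, hinj⟩ := mem_expansion.mp hG
  have key (F' : Finset V) (hF' : F' ∈ Δ) (hGF' : G.image Sigma.fst ⊆ F') :
      G.image Sigma.fst = F' := by
    refine hGF'.antisymm fun v hv ↦ ?_
    by_contra hvG
    let x : (v : V) × Fin (α v) := ⟨v, ⟨0, hα v⟩⟩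
    have hx : ∀ y ∈ G, y.1 ≠ v := fun y hy h ↦ hvG (Finset.mem_image.mpr ⟨y, hy, h⟩)
    have hxG : x ∉ G := fun h ↦ hx x h rfl
    have hins : insert x G ∈ expansion Δ α := by
      refine mem_expansion.mpr ⟨F', hF', ?_, ?_⟩
      · rw [Finset.image_insert, Finset.insert_subset_iff]
        exact ⟨hv, hGF'⟩
      · rw [Finset.coe_insert, Set.injOn_insert (by simpa using hxG)]
        exact ⟨hinj, fun ⟨y, hy, hyx⟩ ↦ hx y hy hyx⟩
    exact hxG (hmax _ hins (Finset.subset_insert x G) ▸ Finset.mem_insert_self x G)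
  have hGeq := key F hF hGF
  rw [hGeq] at key ⊢
  exact ⟨hF, key⟩

lemma IsFacet.image_section {F : Finset V} (hF : IsFacet Δ F) (s : ∀ v, Fin (α v)) :
    IsFacet (expansion Δ α) (F.image fun v ↦ ⟨v, s v⟩) := by
  have himg : (F.image fun v ↦ (⟨v, s v⟩ : (v : V) × Fin (α v))).image Sigma.fst = F := by
    ext; simp
  refine ⟨mem_expansion.mpr ⟨F, hF.1, himg.subset, ?_⟩, fun G hG hsub ↦ hsub.antisymm ?_⟩
  · intro x hx y hy hxy
    simp only [Finset.coe_image, Set.mem_image] at hx hy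
    obtain ⟨v, -, rfl⟩ := hx
    obtain ⟨w, -, rfl⟩ := hy
    obtain rfl : v = w := hxy
    rfl
  · obtain ⟨F', hF', hGF', hinj⟩ := mem_expansion.mp hG
    have hFF' : F = F' := hF.2 F' hF' (himg ▸ (Finset.image_subset_image hsub).trans hGF')
    intro x hx
    have hxF : x.1 ∈ F := hFF' ▸ hGF' (Finset.mem_image_of_mem _ hx)
    have hxs : (⟨x.1, s x.1⟩ : (v : V) × Fin (α v)) ∈ F.image fun v ↦ ⟨v, s v⟩ :=
      Finset.mem_image_of_mem _ hxF
    rwa [← hinj (hsub hxs) hx rfl]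

end Facets

lemma mem_dualFacetIdeal {K : Type*} [Field K] {V : Type*} {Δ : Set (Finset V)}
    {f : MvPolynomial V K} :
    f ∈ dualFacetIdeal K Δ ↔ ∀ m ∈ f.support, ∀ F, IsFacet Δ F → ∃ v ∈ F, m v ≠ 0 := by
  simp only [dualFacetIdeal, varIdeal, Submodule.mem_iInf, MvPolynomial.mem_ideal_span_X_image,
    Set.mem_ofPred_eq, Finset.mem_coe]
  exact ⟨fun h m hm F hF ↦ h F hF m hm, fun h F hF m hm ↦ h m hm F hF⟩

lemma monomial_mem_dualFacetIdeal {K : Type*} [Field K] {V : Type*} {Δ : Set (Finset V)}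
    {m : V →₀ ℕ} (c : K) (hm : ∀ F, IsFacet Δ F → ∃ v ∈ F, m v ≠ 0) :
    MvPolynomial.monomial m c ∈ dualFacetIdeal K Δ := by
  classical
  refine mem_dualFacetIdeal.mpr fun m' hm' ↦ ?_
  rwa [Finset.mem_singleton.mp (MvPolynomial.support_monomial_subset hm')]

section Expansion

open MvPolynomial

variable (K : Type*) [Field K] {V : Type*} (α : V → ℕ)

/-- The homomorphism sending `x_v` to the product of all `x_{v,j}`. -/
noncomputable def expansionHom :
    MvPolynomial V K →ₐ[K] MvPolynomial ((v : V) × Fin (α v)) K :=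
  aeval fun v ↦ ∏ j, X ⟨v, j⟩

/-- A left inverse of `expansionHom`, sending `x_{v,0}` to `x_v` and the other variables to `1`. -/
noncomputable def contractionHom :
    MvPolynomial ((v : V) × Fin (α v)) K →ₐ[K] MvPolynomial V K :=
  aeval fun x ↦ if (x.2 : ℕ) = 0 then X x.1 else 1

variable {α} in
lemma contractionHom_expansionHom (hα : ∀ v, 1 ≤ α v) (f : MvPolynomial V K) :
    contractionHom K α (expansionHom K α f) = f := by
  suffices (contractionHom K α).comp (expansionHom K α) = AlgHom.id K _ from
    DFunLike.congr_fun this f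
  refine algHom_ext fun v ↦ ?_
  have h (j : Fin (α v)) : (j : ℕ) = 0 ↔ j = ⟨0, hα v⟩ := by rw [Fin.ext_iff]
  simp [expansionHom, contractionHom, h]

variable [Fintype V]

/-- The exponent vector of the image of `x^m` under `expansionHom`. -/
noncomputable def expandExponent (m : V →₀ ℕ) : ((v : V) × Fin (α v)) →₀ ℕ :=
  Finsupp.equivFunOnFinite.symm fun x ↦ m x.1

@[simp]
lemma expandExponent_apply (m : V →₀ ℕ) (x : (v : V) × Fin (α v)) :
    expandExponent α m x = m x.1 := rfl

/-- The largest `b` such that the image of `x^b` under `expansionHom` divides `x^m`. -/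
noncomputable def contractExponent (m : ((v : V) × Fin (α v)) →₀ ℕ) : V →₀ ℕ :=
  Finsupp.equivFunOnFinite.symm fun v ↦ ⨅ j, m ⟨v, j⟩

lemma expansionHom_monomial (m : V →₀ ℕ) (c : K) :
    expansionHom K α (monomial m c) = monomial (expandExponent α m) c := by
  rw [expansionHom, aeval_monomial, monomial_eq, algebraMap_eq,
    Finsupp.prod_fintype _ _ (by simp), Finsupp.prod_fintype _ _ (by simp),
    Fintype.prod_sigma]
  simp [Finset.prod_pow]

variable {α}

lemma contractExponent_le {m : ((v : V) × Fin (α v)) →₀ ℕ} (x : (v : V) × Fin (α v)) :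
    contractExponent α m x.1 ≤ m x :=
  ciInf_le (OrderBot.bddBelow _) x.2

lemma expandExponent_contractExponent_le (m : ((v : V) × Fin (α v)) →₀ ℕ) :
    expandExponent α (contractExponent α m) ≤ m :=
  fun x ↦ contractExponent_le x

lemma exists_eq_contractExponent (hα : ∀ v, 1 ≤ α v) (m : ((v : V) × Fin (α v)) →₀ ℕ) (v : V) :
    ∃ j, m ⟨v, j⟩ = contractExponent α m v := by
  have : Nonempty (Fin (α v)) := ⟨⟨0, hα v⟩⟩
  exact exists_eq_ciInf_of_finite

lemma expandExponent_add_inj {a a' : V →₀ ℕ} {b b' : ((v : V) × Fin (α v)) →₀ ℕ}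
    (hb : ∀ v, ∃ j, b ⟨v, j⟩ = 0) (hb' : ∀ v, ∃ j, b' ⟨v, j⟩ = 0) :
    expandExponent α a + b = expandExponent α a' + b' ↔ a = a' ∧ b = b' := by
  refine ⟨fun h ↦ ?_, by rintro ⟨rfl, rfl⟩; rfl⟩
  have h' (v : V) (j : Fin (α v)) : a v + b ⟨v, j⟩ = a' v + b' ⟨v, j⟩ :=
    DFunLike.congr_fun h ⟨v, j⟩
  obtain rfl : a = a' := by
    ext v
    obtain ⟨j, hj⟩ := hb v
    obtain ⟨j', hj'⟩ := hb' v
    have h₁ := h' v j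
    have h₂ := h' v j'
    lia
  exact ⟨rfl, add_left_cancel h⟩

lemma coeff_expansionHom_mul_monomial (f : MvPolynomial V K) (a : V →₀ ℕ)
    {b b' : ((v : V) × Fin (α v)) →₀ ℕ}
    (hb : ∀ v, ∃ j, b ⟨v, j⟩ = 0) (hb' : ∀ v, ∃ j, b' ⟨v, j⟩ = 0) :
    coeff (expandExponent α a + b) (expansionHom K α f * monomial b' 1) =
      if b' = b then coeff a f else 0 := by
  classical
  induction f using MvPolynomial.induction_on' with
  | monomial u c =>
    rw [expansionHom_monomial, monomial_mul, mul_one, coeff_monomial, coeff_monomial]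
    simp only [expandExponent_add_inj hb' hb]
    split_ifs <;> tauto
  | add p q hp hq =>
    rw [map_add, add_mul, coeff_add, hp, hq, coeff_add]
    split_ifs <;> simp

lemma monomial_eq_expansionHom_mul (m : ((v : V) × Fin (α v)) →₀ ℕ) (c : K) :
    monomial m c = expansionHom K α (monomial (contractExponent α m) c) *
      monomial (m - expandExponent α (contractExponent α m)) 1 := by
  rw [expansionHom_monomial, monomial_mul, mul_one,
    add_tsub_cancel_of_le (expandExponent_contractExponent_le m)]

lemma exists_sub_expandExponent_eq_zero (hα : ∀ v, 1 ≤ α v)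
    (m : ((v : V) × Fin (α v)) →₀ ℕ) (v : V) :
    ∃ j, (m - expandExponent α (contractExponent α m)) ⟨v, j⟩ = 0 := by
  obtain ⟨j, hj⟩ := exists_eq_contractExponent hα m v
  exact ⟨j, by simp [hj]⟩

lemma free_expansionHom (hα : ∀ v, 1 ≤ α v) :
    letI := (expansionHom K α).toRingHom.toAlgebra
    Module.Free (MvPolynomial V K) (MvPolynomial ((v : V) × Fin (α v)) K) := by
  classical
  let := (expansionHom K α).toRingHom.toAlgebra
  have smul_def (f : MvPolynomial V K) (g : MvPolynomial ((v : V) × Fin (α v)) K) :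
      f • g = expansionHom K α f * g := rfl
  let B := {b : ((v : V) × Fin (α v)) →₀ ℕ // ∀ v, ∃ j, b ⟨v, j⟩ = 0}
  let e : B → MvPolynomial ((v : V) × Fin (α v)) K := fun b ↦ monomial b.1 1
  have hli : LinearIndependent (MvPolynomial V K) e := by
    refine linearIndependent_iff.mpr fun l hl ↦ ?_
    ext b a
    have := congrArg (coeff (expandExponent α a + b.1)) hl
    simp only [Finsupp.linearCombination_apply, Finsupp.sum, smul_def, e, coeff_sum,
      coeff_expansionHom_mul_monomial K _ a b.2 (Subtype.prop (_ : B)), coeff_zero,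
      Subtype.coe_inj] at this
    rwa [Finset.sum_eq_single b (fun _ _ h ↦ if_neg h) (by simp +contextual), if_pos rfl] at this
  refine .of_basis (Module.Basis.mk hli fun f _ ↦ ?_)
  induction f using MvPolynomial.induction_on' with
  | monomial m c =>
    rw [monomial_eq_expansionHom_mul, ← smul_def]
    exact Submodule.smul_mem _ _
      (Submodule.subset_span ⟨⟨_, exists_sub_expandExponent_eq_zero hα m⟩, rfl⟩)
  | add p q hp hq => exact Submodule.add_mem _ (hp trivial) (hq trivial)

lemma dualFacetIdeal_expansion [DecidableEq V] (hα : ∀ v, 1 ≤ α v) (Δ : Set (Finset V)) :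
    dualFacetIdeal K (expansion Δ α) =
      (dualFacetIdeal K Δ).map (expansionHom K α).toRingHom := by
  apply le_antisymm
  · intro f hf
    rw [mem_dualFacetIdeal] at hf
    rw [f.as_sum]
    refine Ideal.sum_mem _ fun m hm ↦ ?_
    rw [monomial_eq_expansionHom_mul]
    refine Ideal.mul_mem_right _ _ (Ideal.mem_map_of_mem (expansionHom K α).toRingHom
      (monomial_mem_dualFacetIdeal _ fun F hF ↦ ?_))
    choose s hs using exists_eq_contractExponent hα m
    obtain ⟨x, hx, hmx⟩ := hf m hm _ (hF.image_section s)
    obtain ⟨v, hv, rfl⟩ := Finset.mem_image.mp hx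
    exact ⟨v, hv, hs v ▸ hmx⟩
  · refine Ideal.map_le_iff_le_comap.mpr fun f hf ↦ ?_
    rw [mem_dualFacetIdeal] at hf
    rw [f.as_sum]
    refine Ideal.sum_mem _ fun m hm ↦ ?_
    change expansionHom K α _ ∈ dualFacetIdeal K (expansion Δ α)
    rw [expansionHom_monomial]
    refine monomial_mem_dualFacetIdeal _ fun G hG ↦ ?_
    obtain ⟨v, hv, hmv⟩ := hf m hm _ (hG.image_fst hα)
    obtain ⟨x, hx, rfl⟩ := Finset.mem_image.mp hv
    exact ⟨x, hx, hmv⟩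

end Expansion

/-- `pd_S(S/J_Δ) = pd_{S^α}(S^α/J_{Δ^α})`. -/
theorem projDim_dualFacetIdeal_expansion (n : ℕ) (K : Type) [Field K]
    (Δ : Set (Finset (Fin n))) (hΔ : IsComplex Δ)
    (α : Fin n → ℕ) (hα : ∀ i, 1 ≤ α i) :
    projDim (MvPolynomial (Fin n) K) (MvPolynomial (Fin n) K ⧸ dualFacetIdeal K Δ) =
      projDim (MvPolynomial ((i : Fin n) × Fin (α i)) K)
        (MvPolynomial ((i : Fin n) × Fin (α i)) K ⧸ dualFacetIdeal K (expansion Δ α)) := by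
  let := (expansionHom K α).toRingHom.toAlgebra
  have := free_expansionHom K hα
  let ρ : MvPolynomial ((i : Fin n) × Fin (α i)) K →ₗ[MvPolynomial (Fin n) K]
      MvPolynomial (Fin n) K :=
    { toFun := contractionHom K α
      map_add' := map_add _
      map_smul' := fun f g ↦ by
        change contractionHom K α (expansionHom K α f * g) = f * contractionHom K α g
        rw [map_mul, contractionHom_expansionHom K hα] }
  rw [dualFacetIdeal_expansion K hα]
  exact (projDim_quotient_map ρ (map_one (contractionHom K α)) _).symm
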